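/- Let S' be the m×n matrix with S'(i,i) = 1 for 1 ≤ i ≤ m and all other entries 0, and set A = P⁻¹·S'·Q⁻¹ (an m×n integer matrix, since P and Q are unimodular). Then every row of A lies in Λ, the rows of A are linearly independent over ℚ and span the same ℚ-subspace of ℚⁿ as the rows of B, and the rows of A generate Λ as an additive group. -/

import Mathlib

open Matrix

/-- The rows of a matrix product `M * A` lie in the row space of `A`. -/
lemma span_rows_mul_le {K l m n : Type*} [CommRing K] [Fintype m]
    (M : Matrix l m K) (A : Matrix m n K) :
    Submodule.span K (Set.range (M * A).row) ≤ Submodule.span K (Set.range A.row) := by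
  rw [Submodule.span_le]
  rintro _ ⟨i, rfl⟩
  rw [← range_vecMulLinear]
  exact ⟨M i, by ext j; simp [vecMul, Matrix.mul_apply, dotProduct]⟩

/-- If an integer matrix `A` has an integer right inverse, then every integer vector in the rational
row space of `A` is an integer combination of the rows of `A`. -/
lemma mem_closure_rows_of_mul_eq_one {m n : Type*} [Fintype m] [DecidableEq m] [Fintype n]
    {A : Matrix m n ℤ} {R : Matrix n m ℤ} (hR : A * R = 1) {v : n → ℤ}
    (hv : (fun j => (v j : ℚ)) ∈
      Submodule.span ℚ (Set.range (A.map (Int.castRingHom ℚ)).row)) :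
    v ∈ AddSubgroup.closure (Set.range A.row) := by
  rw [← range_vecMulLinear] at hv
  obtain ⟨c, hc⟩ := hv
  change c ᵥ* A.map (Int.castRingHom ℚ) = Int.castRingHom ℚ ∘ v at hc
  have hRq : A.map (Int.castRingHom ℚ) * R.map (Int.castRingHom ℚ) = 1 := by
    rw [← Matrix.map_mul, hR]
    simp
  have hcR : c = Int.castRingHom ℚ ∘ (v ᵥ* R) := by
    ext i
    rw [Function.comp_apply, RingHom.map_vecMul, ← hc, vecMul_vecMul, hRq, vecMul_one]
  have hv : v = (v ᵥ* R) ᵥ* A := by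
    ext j
    have h := congrFun hc j
    rw [hcR, Function.comp_apply, ← RingHom.map_vecMul] at h
    exact (Int.cast_injective (α := ℚ) h).symm
  rw [hv, vecMul_eq_sum]
  exact sum_mem fun i _ => zsmul_mem (AddSubgroup.subset_closure (Set.mem_range_self i)) _

theorem rows_of_modified_smith_matrix_generate_lattice
    {m n : ℕ} (hmn : m ≤ n)
    (B : Matrix (Fin m) (Fin n) ℤ)
    (hB : LinearIndependent ℚ (fun i : Fin m => fun j : Fin n => (B i j : ℚ)))
    (Λ : AddSubgroup (Fin n → ℤ))
    (hΛ : ∀ v : Fin n → ℤ, v ∈ Λ ↔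
      (fun j => (v j : ℚ)) ∈
        Submodule.span ℚ (Set.range fun i : Fin m => fun j : Fin n => (B i j : ℚ)))
    (P : Matrix (Fin m) (Fin m) ℤ) (Q : Matrix (Fin n) (Fin n) ℤ)
    (hP : IsUnit P.det) (hQ : IsUnit Q.det)
    (d : Fin m → ℤ) (hd : ∀ i, 0 < d i)
    (hS : P * B * Q = Matrix.of fun (i : Fin m) (j : Fin n) =>
      if (i : ℕ) = (j : ℕ) then d i else 0)
    (S' : Matrix (Fin m) (Fin n) ℤ)
    (hS' : S' = Matrix.of fun (i : Fin m) (j : Fin n) =>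
      if (i : ℕ) = (j : ℕ) then 1 else 0)
    (A : Matrix (Fin m) (Fin n) ℤ) (hA : A = P⁻¹ * S' * Q⁻¹) :
    (∀ i, A i ∈ Λ) ∧
    LinearIndependent ℚ (fun i : Fin m => fun j : Fin n => (A i j : ℚ)) ∧
    Submodule.span ℚ (Set.range fun i : Fin m => fun j : Fin n => (A i j : ℚ)) =
      Submodule.span ℚ (Set.range fun i : Fin m => fun j : Fin n => (B i j : ℚ)) ∧
    AddSubgroup.closure (Set.range fun i : Fin m => A i) = Λ := by
  have hPP : P * P⁻¹ = 1 := mul_nonsing_inv P hP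
  have hPP' : P⁻¹ * P = 1 := nonsing_inv_mul P hP
  have hQQ : Q * Q⁻¹ = 1 := mul_nonsing_inv Q hQ
  have hQQ' : Q⁻¹ * Q = 1 := nonsing_inv_mul Q hQ
  have hSS : S' * S'ᵀ = 1 := by
    ext i k
    rw [hS', Matrix.mul_apply, Finset.sum_eq_single (Fin.castLE hmn i)]
    · simp [Matrix.one_apply, Fin.ext_iff, eq_comm]
    · intro j _ hj
      have : (i : ℕ) ≠ j := fun h => hj (Fin.ext h.symm)
      simp [this]
    · simp
  have hDS : P * B * Q = diagonal d * S' := by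
    rw [hS, hS']
    ext i j
    simp [diagonal_mul]
  have hR : A * (Q * S'ᵀ * P) = 1 := by
    calc A * (Q * S'ᵀ * P) = P⁻¹ * (S' * ((Q⁻¹ * Q) * S'ᵀ)) * P := by
          simp only [hA, Matrix.mul_assoc]
      _ = 1 := by rw [hQQ', Matrix.one_mul, hSS, Matrix.mul_one, hPP']
  have hBA : B = P⁻¹ * diagonal d * P * A := by
    calc B = P⁻¹ * (P * B * Q) * Q⁻¹ := by
          simp only [Matrix.mul_assoc, hQQ, Matrix.mul_one]
          rw [← Matrix.mul_assoc, hPP', Matrix.one_mul]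
      _ = P⁻¹ * diagonal d * ((P * P⁻¹) * S') * Q⁻¹ := by
          rw [hDS, hPP, Matrix.one_mul]
          simp only [Matrix.mul_assoc]
      _ = P⁻¹ * diagonal d * P * A := by simp only [hA, Matrix.mul_assoc]
  have hBAq : B.map (Int.castRingHom ℚ) =
      (P⁻¹ * diagonal d * P).map (Int.castRingHom ℚ) * A.map (Int.castRingHom ℚ) := by
    rw [← Matrix.map_mul, ← hBA]
  have hdet : IsUnit ((P⁻¹ * diagonal d * P).map (Int.castRingHom ℚ)).det := by
    have h : (P⁻¹ * diagonal d * P).det = ∏ i, d i := by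
      rw [det_mul, det_mul, det_diagonal, mul_right_comm, ← det_mul, hPP', det_one, one_mul]
    rw [← RingHom.mapMatrix_apply, ← RingHom.map_det, h, isUnit_iff_ne_zero]
    simpa [Finset.prod_eq_zero_iff] using fun i => (hd i).ne'
  have hABq : A.map (Int.castRingHom ℚ) =
      ((P⁻¹ * diagonal d * P).map (Int.castRingHom ℚ))⁻¹ * B.map (Int.castRingHom ℚ) := by
    rw [hBAq, ← Matrix.mul_assoc, nonsing_inv_mul _ hdet, Matrix.one_mul]
  have hspan : Submodule.span ℚ (Set.range fun i : Fin m => fun j : Fin n => (A i j : ℚ)) =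
      Submodule.span ℚ (Set.range fun i : Fin m => fun j : Fin n => (B i j : ℚ)) := by
    change Submodule.span ℚ (Set.range (A.map (Int.castRingHom ℚ)).row) =
      Submodule.span ℚ (Set.range (B.map (Int.castRingHom ℚ)).row)
    apply le_antisymm
    · rw [hABq]
      exact span_rows_mul_le _ _
    · rw [hBAq]
      exact span_rows_mul_le _ _
  have hmem : ∀ i, A i ∈ Λ := fun i => by
    rw [hΛ, ← hspan]
    exact Submodule.subset_span ⟨i, rfl⟩
  refine ⟨hmem, ?_, hspan, le_antisymm ?_ fun v hv => ?_⟩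
  · rw [linearIndependent_iff_card_eq_finrank_span] at hB ⊢
    rw [hB, Set.finrank, Set.finrank, hspan]
  · rw [AddSubgroup.closure_le]
    rintro _ ⟨i, rfl⟩
    exact hmem i
  · rw [hΛ, ← hspan] at hv
    exact mem_closure_rows_of_mul_eq_one hR hv
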